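/- For all integers m ≥ 2 and k ≥ 2, p_OL(k, m) ≤ m³·(k+1)·(m/(m-1))^k. -/

import Mathlib

/-- The state of the online panchromatic coloring game after a new vertex, declared to belong to
the hyperedges in `J`, is given color `c`: each hyperedge records (number of its vertices so far,
set of colors appearing on its vertices so far). -/
def panUpdate {n r : ℕ} (st : Fin n → ℕ × Finset (Fin r)) (J : Finset (Fin n)) (c : Fin r) :
    Fin n → ℕ × Finset (Fin r) :=
  fun j => if j ∈ J then ((st j).1 + 1, insert c (st j).2) else st j

/-- `PresenterWins k st` : in the online panchromatic `r`-coloring game on a `k`-uniform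
hypergraph with hyperedges indexed by `Fin n`, from the state `st` (each hyperedge paired with
its current number of vertices and its current set of colors), Presenter has a winning strategy:
Presenter can force the game to end (every hyperedge having exactly `k` vertices) with some
hyperedge containing fewer than `r` colors. On each turn Presenter introduces a new vertex,
declaring it to belong to a nonempty set `J` of hyperedges, none of which is already full;
Colorer then assigns the vertex one of the `r` colors. -/
inductive PresenterWins (k : ℕ) {n r : ℕ} : (Fin n → ℕ × Finset (Fin r)) → Prop
  | win (st : Fin n → ℕ × Finset (Fin r)) (hfull : ∀ j, (st j).1 = k)
      (j : Fin n) (hj : (st j).2.card < r) : PresenterWins k st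
  | step (st : Fin n → ℕ × Finset (Fin r)) (J : Finset (Fin n)) (hJ : J.Nonempty)
      (hroom : ∀ j ∈ J, (st j).1 < k)
      (h : ∀ c : Fin r, PresenterWins k (panUpdate st J c)) : PresenterWins k st

/-- `pOL k r` : the minimum number `n` of hyperedges such that Presenter has a winning strategy
in the online panchromatic `r`-coloring game on a `k`-uniform hypergraph with `n` hyperedges. -/
noncomputable def pOL (k r : ℕ) : ℕ :=
  sInf {n : ℕ | PresenterWins k (fun _ : Fin n => (0, (∅ : Finset (Fin r))))}

/-- The hyperedges of class `c` that still avoid the color `c` and have exactly `i` vertices. -/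
def aliveEdges {n m : ℕ} (cls : Fin n → Fin m) (st : Fin n → ℕ × Finset (Fin m)) (c : Fin m)
    (i : ℕ) : Finset (Fin n) :=
  Finset.univ.filter fun j => cls j = c ∧ c ∉ (st j).2 ∧ (st j).1 = i

theorem mem_aliveEdges {n m : ℕ} {cls : Fin n → Fin m} {st : Fin n → ℕ × Finset (Fin m)}
    {c : Fin m} {i : ℕ} {j : Fin n} :
    j ∈ aliveEdges cls st c i ↔ cls j = c ∧ c ∉ (st j).2 ∧ (st j).1 = i := by
  simp [aliveEdges]

/-- Block sizes: `B i` hyperedges with `i` vertices form one block. -/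
structure IsBlockSize (m k : ℕ) (B : ℕ → ℕ) : Prop where
  pos : ∀ i, 0 < B i
  ratio : ∀ i < k, (m : ℚ) * B (i + 1) ≤ (m - 1) * B i
  slack : ∀ i < k, ((m : ℚ) - 1) * B i ≤ m * B (i + 1) + (m - 1)

/-- The invariant preserved by Presenter's strategy, in terms of the number `a c i` of
hyperedges with `i` vertices that are alive in class `c`. -/
structure BlockInvariant {m : ℕ} (k N : ℕ) (B : ℕ → ℕ) (a : Fin m → ℕ → ℕ) : Prop where
  potential : (m : ℚ) * N ≤ ∑ c, ∑ i ∈ Finset.range (k + 1), (a c i : ℚ) / B i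
  level_zero : ∀ c, a c 0 ≤ N * B 0
  shape : ∀ c, ∃ t, (∀ i < k, a c (i + 1) < B i + if i + 1 = t then B (i + 1) else 0) ∧
    ∀ i, t < i → i ≤ k → a c i < B i

theorem IsBlockSize.succ_le {m k : ℕ} {B : ℕ → ℕ} (hB : IsBlockSize m k B) (hm : 2 ≤ m) {i : ℕ}
    (hi : i < k) : B (i + 1) ≤ B i := by
  have h := hB.ratio i hi
  have h2 : (2 : ℚ) ≤ m := by exact_mod_cast hm
  have : (B (i + 1) : ℚ) ≤ B i := by
    have h0 : (0 : ℚ) ≤ B (i + 1) := by positivity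
    by_contra! hlt
    nlinarith
  exact_mod_cast this

theorem BlockInvariant.exists_full_block {m k N : ℕ} {B : ℕ → ℕ} {a : Fin m → ℕ → ℕ}
    (hm : 2 ≤ m) (hk : 1 ≤ k) (hN : (m + 1) * k ≤ N) (hB : IsBlockSize m k B)
    (h : BlockInvariant k N B a) (hlast : ∀ c, a c k = 0) (c : Fin m) :
    ∃ i < k, B i ≤ a c i := by
  by_contra! hc
  have h2 : (2 : ℚ) ≤ m := by exact_mod_cast hm
  have hm1 : (0 : ℚ) < m - 1 := by linarith
  have hpos : ∀ i, (0 : ℚ) < B i := fun i => by exact_mod_cast hB.pos i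
  obtain ⟨l, rfl⟩ : ∃ l, k = l + 1 := ⟨k - 1, by omega⟩
  have hstuck : ∑ i ∈ Finset.range (l + 1 + 1), (a c i : ℚ) / B i ≤ (l + 1 : ℕ) := by
    rw [Finset.sum_range_succ, hlast c]
    simp only [Nat.cast_zero, zero_div, add_zero]
    calc ∑ i ∈ Finset.range (l + 1), (a c i : ℚ) / B i
        ≤ ∑ i ∈ Finset.range (l + 1), (1 : ℚ) := by
          refine Finset.sum_le_sum fun i hi => ?_
          rw [div_le_one (hpos i)]
          exact_mod_cast (hc i (Finset.mem_range.1 hi)).le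
      _ = (l + 1 : ℕ) := by simp
  have hother : ∀ d : Fin m, ∑ i ∈ Finset.range (l + 1 + 1), (a d i : ℚ) / B i
      ≤ N + 1 + l * (m / (m - 1)) := by
    intro d
    obtain ⟨t, ht, -⟩ := h.shape d
    rw [Finset.sum_range_succ, hlast d, Finset.sum_range_succ']
    simp only [Nat.cast_zero, zero_div, add_zero]
    have h0 : (a d 0 : ℚ) / B 0 ≤ N := by
      rw [div_le_iff₀ (hpos 0)]
      exact_mod_cast h.level_zero d
    have hs : ∑ i ∈ Finset.range l, (a d (i + 1) : ℚ) / B (i + 1)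
        ≤ ∑ i ∈ Finset.range l, ((m : ℚ) / (m - 1) + if i + 1 = t then 1 else 0) := by
      refine Finset.sum_le_sum fun i hi => ?_
      have hil : i < l + 1 := by have := Finset.mem_range.1 hi; omega
      have h1 := hB.slack i hil
      have h3 : (a d (i + 1) : ℚ) + 1 ≤ B i + if i + 1 = t then (B (i + 1) : ℚ) else 0 := by
        exact_mod_cast ht i hil
      have h4 : (B i : ℚ) - 1 ≤ m / (m - 1) * B (i + 1) := by
        rw [div_mul_eq_mul_div, le_div_iff₀ hm1]
        linarith
      rw [div_le_iff₀ (hpos _)]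
      split_ifs at h3 ⊢ <;> linarith
    have hone : ∑ i ∈ Finset.range l, (if i + 1 = t then (1 : ℚ) else 0) ≤ 1 := by
      rw [Finset.sum_boole]
      have : ((Finset.range l).filter fun i => i + 1 = t).card ≤ 1 := by
        rw [Finset.card_le_one]
        intro x hx y hy
        simp only [Finset.mem_filter] at hx hy
        omega
      exact_mod_cast this
    rw [Finset.sum_add_distrib] at hs
    simp only [Finset.sum_const, Finset.card_range, nsmul_eq_mul] at hs
    linarith
  have htotal := h.potential
  rw [← Finset.add_sum_erase _ _ (Finset.mem_univ c)] at htotal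
  have hrest := Finset.sum_le_sum (s := Finset.univ.erase c) fun d _ => hother d
  rw [Finset.sum_const, Finset.card_erase_of_mem (Finset.mem_univ c), Finset.card_univ,
    Fintype.card_fin, nsmul_eq_mul, Nat.cast_sub (by omega)] at hrest
  have hmul : ((m : ℚ) - 1) * (N + 1 + l * (m / (m - 1))) = (m - 1) * (N + 1) + l * m := by
    field_simp
  have hN' : ((m : ℚ) + 1) * (l + 1) ≤ N := by exact_mod_cast hN
  push_cast at hrest hstuck
  rw [hmul] at hrest
  linarith

theorem BlockInvariant.step {m k N : ℕ} {B : ℕ → ℕ} {a a' : Fin m → ℕ → ℕ} (hm : 2 ≤ m)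
    (hB : IsBlockSize m k B) (h : BlockInvariant k N B a) (lev : Fin m → ℕ)
    (hlev : ∀ c, lev c < k) (hfull : ∀ c, B (lev c) ≤ a c (lev c))
    (htop : ∀ c i, lev c < i → i < k → a c i < B i) (hlast : ∀ c, a c k = 0) (x : Fin m)
    (hx : ∀ i, a' x i + (if i = lev x then B (lev x) else 0) = a x i)
    (hne : ∀ c ≠ x, ∀ i, a' c i + (if i = lev c then B (lev c) else 0) =
      a c i + if i = lev c + 1 then B (lev c) else 0) :
    BlockInvariant k N B a' := by
  have h2 : (2 : ℚ) ≤ m := by exact_mod_cast hm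
  have hm1 : (0 : ℚ) < m - 1 := by linarith
  have hpos : ∀ i, (0 : ℚ) < B i := fun i => by exact_mod_cast hB.pos i
  have hxle : ∀ i, a' x i ≤ a x i := fun i => by have := hx i; omega
  refine ⟨?_, fun c => ?_, fun c => ?_⟩
  · refine h.potential.trans ?_
    have hloss : ∑ i ∈ Finset.range (k + 1), (a' x i : ℚ) / B i =
        ∑ i ∈ Finset.range (k + 1), (a x i : ℚ) / B i - 1 := by
      have : ∀ i ∈ Finset.range (k + 1), (a' x i : ℚ) / B i =
          (a x i : ℚ) / B i - if i = lev x then 1 else 0 := by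
        intro i _
        rw [← hx i]
        have := (hpos i).ne'
        split_ifs with hi
        · subst hi; push_cast; field_simp; ring
        · simp
      rw [Finset.sum_congr rfl this, Finset.sum_sub_distrib, Finset.sum_ite_eq',
        if_pos (Finset.mem_range.2 (by have := hlev x; omega))]
    have hgain : ∀ c ≠ x, ∑ i ∈ Finset.range (k + 1), (a c i : ℚ) / B i + 1 / (m - 1) ≤
        ∑ i ∈ Finset.range (k + 1), (a' c i : ℚ) / B i := by
      intro c hc
      have : ∀ i ∈ Finset.range (k + 1), (a' c i : ℚ) / B i = (a c i : ℚ) / B i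
          - (if i = lev c then 1 else 0)
          + (if i = lev c + 1 then (B (lev c) : ℚ) / B (lev c + 1) else 0) := by
        intro i _
        have hi := hne c hc i
        have hi' : (a' c i : ℚ) + (if i = lev c then (B (lev c) : ℚ) else 0) =
          a c i + if i = lev c + 1 then (B (lev c) : ℚ) else 0 := by exact_mod_cast hi
        rw [← eq_sub_iff_add_eq] at hi'
        rw [hi']
        have := (hpos i).ne'
        split_ifs with h1 h3 h3
        · omega
        · subst h1; field_simp; ring
        · subst h3; field_simp; ring
        · ring
      rw [Finset.sum_congr rfl this, Finset.sum_add_distrib, Finset.sum_sub_distrib,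
        Finset.sum_ite_eq', Finset.sum_ite_eq',
        if_pos (Finset.mem_range.2 (by have := hlev c; omega)),
        if_pos (Finset.mem_range.2 (by have := hlev c; omega))]
      have hr : (1 : ℚ) + 1 / (m - 1) ≤ (B (lev c) : ℚ) / B (lev c + 1) := by
        rw [le_div_iff₀ (hpos _)]
        have := hB.ratio _ (hlev c)
        have e : ((1 : ℚ) + 1 / (m - 1)) * B (lev c + 1) = m * B (lev c + 1) / (m - 1) := by
          field_simp; ring
        rw [e, div_le_iff₀ hm1]
        linarith
      linarith
    rw [← Finset.add_sum_erase _ _ (Finset.mem_univ x),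
      ← Finset.add_sum_erase _ (fun c => ∑ i ∈ Finset.range (k + 1), (a' c i : ℚ) / B i)
        (Finset.mem_univ x), hloss]
    have hrest := Finset.sum_le_sum (s := Finset.univ.erase x)
      fun c hc => hgain c (Finset.ne_of_mem_erase hc)
    rw [Finset.sum_add_distrib, Finset.sum_const, Finset.card_erase_of_mem (Finset.mem_univ x),
      Finset.card_univ, Fintype.card_fin, nsmul_eq_mul, Nat.cast_sub (by omega), Nat.cast_one,
      mul_one_div_cancel hm1.ne'] at hrest
    linarith
  · by_cases hc : c = x
    · subst hc; exact (hxle 0).trans (h.level_zero c)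
    · have := hne c hc 0
      have := h.level_zero c
      simp at *
      omega
  · obtain ⟨t, ht, ht'⟩ := h.shape c
    by_cases hc : c = x
    · subst hc
      exact ⟨t, fun i hi => (hxle _).trans_lt (ht i hi),
        fun i h1 h3 => (hxle _).trans_lt (ht' i h1 h3)⟩
    · have hlt : lev c ≤ t := by
        by_contra! hlt
        exact absurd (hfull c) (not_le.2 (ht' _ hlt (hlev c).le))
      have habove : ∀ i, lev c < i → i ≤ k → a c i < B i := by
        intro i h1 h3
        rcases h3.lt_or_eq with h4 | rfl
        · exact htop c i h1 h4
        · rw [hlast]; exact hB.pos _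
      refine ⟨lev c + 1, fun i hi => ?_, fun i h1 h3 => ?_⟩
      · have e := hne c hc (i + 1)
        have h1 := ht i hi
        have h5 := hB.succ_le hm hi
        rcases lt_trichotomy (i + 1) (lev c) with h6 | h6 | h6
        · rw [if_neg (by omega)] at h1
          rw [if_neg (by omega), if_neg (by omega)] at e
          rw [if_neg (by omega)]
          omega
        · rw [← h6, if_pos rfl, if_neg (by omega)] at e
          rw [if_neg (by omega)]
          split_ifs at h1 <;> omega
        · have h7 := habove (i + 1) h6 (by omega)
          rw [if_neg (by omega)] at e
          by_cases h8 : i = lev c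
          · subst h8
            simp at *
            omega
          · rw [if_neg (by omega)] at e
            rw [if_neg (by omega)]
            omega
      · have e := hne c hc i
        rw [if_neg (by omega), if_neg (by omega)] at e
        have := habove i (by omega) h3
        omega

theorem sum_remaining_panUpdate_lt {n r k : ℕ} {st : Fin n → ℕ × Finset (Fin r)}
    {J : Finset (Fin n)} (hJ : J.Nonempty) (hroom : ∀ j ∈ J, (st j).1 < k) (c : Fin r) :
    ∑ j, (k - (panUpdate st J c j).1) < ∑ j, (k - (st j).1) := by
  obtain ⟨j, hj⟩ := hJ
  refine Finset.sum_lt_sum (fun i _ => ?_) ⟨j, Finset.mem_univ j, ?_⟩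
  · unfold panUpdate; split_ifs <;> simp; omega
  · have := hroom j hj
    simp only [panUpdate, if_pos hj]; omega

theorem panUpdate_fst_le {n r k : ℕ} {st : Fin n → ℕ × Finset (Fin r)} {J : Finset (Fin n)}
    (hroom : ∀ j ∈ J, (st j).1 < k) (hle : ∀ j, (st j).1 ≤ k) (c : Fin r) (j : Fin n) :
    (panUpdate st J c j).1 ≤ k := by
  unfold panUpdate
  split_ifs with hj
  · exact hroom j hj
  · exact hle j

theorem presenterWins_of_full_edge {n r k : ℕ} (st : Fin n → ℕ × Finset (Fin r))
    (hle : ∀ j, (st j).1 ≤ k) (j : Fin n) (hjk : (st j).1 = k) (hj : (st j).2.card < r) :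
    PresenterWins k st := by
  induction hd : ∑ j, (k - (st j).1) using Nat.strong_induction_on generalizing st with
  | _ d ih =>
    by_cases hfull : ∀ i, (st i).1 = k
    · exact .win st hfull j hj
    · push Not at hfull
      obtain ⟨i, hi⟩ := hfull
      have hroom : ∀ l ∈ ({i} : Finset (Fin n)), (st l).1 < k := by
        simpa using lt_of_le_of_ne (hle i) hi
      have hJ : ({i} : Finset (Fin n)).Nonempty := Finset.singleton_nonempty i
      have hji : j ∉ ({i} : Finset (Fin n)) := by
        rw [Finset.mem_singleton]; rintro rfl; exact hi hjk
      refine .step st {i} hJ hroom fun c => ?_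
      refine ih _ (hd ▸ sum_remaining_panUpdate_lt hJ hroom c) _
        (panUpdate_fst_le hroom hle c) ?_ ?_ rfl
      · simpa [panUpdate, hji] using hjk
      · simpa [panUpdate, hji] using hj

theorem presenterWins_of_blockInvariant {n m k N : ℕ} {B : ℕ → ℕ} (hm : 2 ≤ m) (hk : 1 ≤ k)
    (hN : (m + 1) * k ≤ N) (hB : IsBlockSize m k B) (cls : Fin n → Fin m)
    (st : Fin n → ℕ × Finset (Fin m)) (hle : ∀ j, (st j).1 ≤ k)
    (h : BlockInvariant k N B fun c i => (aliveEdges cls st c i).card) :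
    PresenterWins k st := by
  induction hd : ∑ j, (k - (st j).1) using Nat.strong_induction_on generalizing st with
  | _ d ih =>
    by_cases hlast : ∀ c, (aliveEdges cls st c k).card = 0
    · have hex := h.exists_full_block hm hk hN hB hlast
      have htop : ∀ c, ∃ i < k, B i ≤ (aliveEdges cls st c i).card ∧
          ∀ l, i < l → l < k → (aliveEdges cls st c l).card < B l := by
        intro c
        let s := (Finset.range k).filter fun i => B i ≤ (aliveEdges cls st c i).card
        have hs : s.Nonempty := by
          obtain ⟨i, hi, hi'⟩ := hex c
          exact ⟨i, by simp [s, hi, hi']⟩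
        have hmem := Finset.max'_mem s hs
        simp only [s, Finset.mem_filter, Finset.mem_range] at hmem
        refine ⟨_, hmem.1, hmem.2, fun l h1 h3 => ?_⟩
        by_contra! h4
        exact absurd (Finset.le_max' s l (by simp [s, h3, h4])) (not_le.2 h1)
      choose lev hlev hfull habove using htop
      choose S hS hScard using fun c => Finset.exists_subset_card_eq (hfull c)
      let J : Finset (Fin n) := Finset.univ.filter fun j => j ∈ S (cls j)
      have hmemS : ∀ c, ∀ j ∈ S c, cls j = c ∧ c ∉ (st j).2 ∧ (st j).1 = lev c :=
        fun c j hj => mem_aliveEdges.1 (hS c hj)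
      have hmemJ : ∀ j, j ∈ J ↔ j ∈ S (cls j) := fun j => by simp [J]
      have hJ : J.Nonempty := by
        let c : Fin m := ⟨0, by omega⟩
        obtain ⟨j, hj⟩ := Finset.card_pos.1 ((hScard c).symm ▸ hB.pos (lev c))
        exact ⟨j, (hmemJ j).2 ((hmemS c j hj).1.symm ▸ hj)⟩
      have hroom : ∀ j ∈ J, (st j).1 < k := fun j hj => by
        rw [(hmemS _ j ((hmemJ j).1 hj)).2.2]; exact hlev _
      refine .step st J hJ hroom fun x => ?_
      refine ih _ (hd ▸ sum_remaining_panUpdate_lt hJ hroom x) _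
        (panUpdate_fst_le hroom hle x) ?_ rfl
      refine h.step hm hB lev hlev hfull habove hlast x (fun i => ?_) fun c hc i => ?_
      · have e : aliveEdges cls (panUpdate st J x) x i =
            aliveEdges cls st x i \ (if i = lev x then S x else ∅) := by
          ext j
          have h1 := hmemS x j
          have h3 := hmemJ j
          rw [Finset.mem_sdiff, mem_aliveEdges, mem_aliveEdges]
          unfold panUpdate
          by_cases hj : cls j = x
          · rw [hj] at h3
            split_ifs <;> grind
          · simp [hj]
        have hsub : (if i = lev x then S x else ∅) ⊆ aliveEdges cls st x i := by
          split_ifs with hi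
          · subst hi; exact hS x
          · simp
        have hcard : (if i = lev x then S x else ∅).card =
            if i = lev x then B (lev x) else 0 := by
          split_ifs
          · exact hScard x
          · simp
        rw [e, ← hcard, Finset.card_sdiff_add_card_eq_card hsub]
      · have e : aliveEdges cls (panUpdate st J x) c i =
            (aliveEdges cls st c i \ (if i = lev c then S c else ∅)) ∪
              (if i = lev c + 1 then S c else ∅) := by
          ext j
          have h1 := hmemS c j
          have h3 := hmemJ j
          rw [Finset.mem_union, Finset.mem_sdiff, mem_aliveEdges, mem_aliveEdges]
          unfold panUpdate
          by_cases hj : cls j = c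
          · rw [hj] at h3
            split_ifs <;> grind
          · have : j ∉ S c := fun h4 => hj (h1 h4).1
            split_ifs <;> simp [hj, this]
        have hsub : (if i = lev c then S c else ∅) ⊆ aliveEdges cls st c i := by
          split_ifs with hi
          · subst hi; exact hS c
          · simp
        have hdisj : Disjoint (aliveEdges cls st c i \ (if i = lev c then S c else ∅))
            (if i = lev c + 1 then S c else ∅) := by
          rw [Finset.disjoint_left]
          intro j h1 h3
          rw [Finset.mem_sdiff, mem_aliveEdges] at h1
          split_ifs at h3 with hi
          · have := hmemS c j h3
            omega
          · simp at h3
        have hcard : ∀ p : Prop, ∀ [Decidable p], (if p then S c else ∅).card =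
            if p then B (lev c) else 0 := by
          intro p _
          split_ifs
          · exact hScard c
          · simp
        rw [e, Finset.card_union_of_disjoint hdisj, hcard, ← hcard (i = lev c),
          add_right_comm, Finset.card_sdiff_add_card_eq_card hsub]
    · push Not at hlast
      obtain ⟨c, hc⟩ := hlast
      obtain ⟨j, hj⟩ := Finset.card_pos.1 (Nat.pos_of_ne_zero hc)
      obtain ⟨-, hcj, hjk⟩ := mem_aliveEdges.1 hj
      refine presenterWins_of_full_edge st hle j hjk ?_
      have := Finset.card_lt_univ_of_notMem hcj
      rwa [Fintype.card_fin] at this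

/-- The sequence starting at `1` in which each term is `(r + 1) / r` times the preceding one,
rounded up. -/
def ceilGrowth (r : ℕ) : ℕ → ℕ
  | 0 => 1
  | t + 1 => ((r + 1) * ceilGrowth r t + (r - 1)) / r

theorem le_ceilGrowth_succ {r : ℕ} (hr : 1 ≤ r) (t : ℕ) :
    (r + 1) * ceilGrowth r t ≤ r * ceilGrowth r (t + 1) := by
  have := Nat.lt_div_mul_add (a := (r + 1) * ceilGrowth r t + (r - 1)) (b := r) hr
  rw [ceilGrowth, mul_comm r]
  omega

theorem ceilGrowth_succ_le {r : ℕ} (hr : 1 ≤ r) (t : ℕ) :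
    r * ceilGrowth r (t + 1) + 1 ≤ (r + 1) * ceilGrowth r t + r := by
  have := Nat.div_mul_le_self ((r + 1) * ceilGrowth r t + (r - 1)) r
  rw [ceilGrowth, mul_comm r]
  omega

theorem ceilGrowth_pos {r : ℕ} (hr : 1 ≤ r) (t : ℕ) : 0 < ceilGrowth r t := by
  induction t with
  | zero => simp [ceilGrowth]
  | succ t ih =>
    have := le_ceilGrowth_succ hr t
    exact Nat.pos_of_mul_pos_left (lt_of_lt_of_le (by positivity) this)

theorem ceilGrowth_le {r : ℕ} (hr : 1 ≤ r) (t : ℕ) :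
    (ceilGrowth r t : ℚ) + (r - 1) ≤ r * (((r : ℚ) + 1) / r) ^ t := by
  have hr' : (1 : ℚ) ≤ r := by exact_mod_cast hr
  have hr0 : (0 : ℚ) < r := by linarith
  induction t with
  | zero => simp [ceilGrowth]
  | succ t ih =>
    have h : (r : ℚ) * ceilGrowth r (t + 1) + 1 ≤ (r + 1) * ceilGrowth r t + r := by
      exact_mod_cast ceilGrowth_succ_le hr t
    have e : (r : ℚ) * (((r : ℚ) + 1) / r) ^ (t + 1) =
        (r + 1) * (r * (((r : ℚ) + 1) / r) ^ t) / r := by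
      rw [pow_succ]; field_simp
    rw [e, le_div_iff₀ hr0]
    nlinarith

theorem isBlockSize_ceilGrowth {r k : ℕ} (hr : 1 ≤ r) :
    IsBlockSize (r + 1) k fun i => ceilGrowth r (k - i) where
  pos i := ceilGrowth_pos hr _
  ratio i hi := by
    have e : k - i = k - (i + 1) + 1 := by omega
    have := le_ceilGrowth_succ hr (k - (i + 1))
    rw [← e] at this
    push_cast
    rw [add_sub_cancel_right]
    exact_mod_cast this
  slack i hi := by
    have e : k - i = k - (i + 1) + 1 := by omega
    have := ceilGrowth_succ_le hr (k - (i + 1))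
    rw [← e] at this
    push_cast
    rw [add_sub_cancel_right]
    exact_mod_cast (Nat.le_succ _).trans this

theorem presenterWins_init {m k N : ℕ} {B : ℕ → ℕ} (hm : 2 ≤ m) (hk : 1 ≤ k)
    (hN : (m + 1) * k ≤ N) (hB : IsBlockSize m k B) :
    PresenterWins k (fun _ : Fin (m * (N * B 0)) => (0, (∅ : Finset (Fin m)))) := by
  let cls : Fin (m * (N * B 0)) → Fin m := fun j => (finProdFinEquiv.symm j).1
  have hcard : ∀ c i, (aliveEdges cls (fun _ => (0, (∅ : Finset (Fin m)))) c i).card =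
      if i = 0 then N * B 0 else 0 := by
    intro c i
    split_ifs with hi
    · subst hi
      have e : aliveEdges cls (fun _ => (0, (∅ : Finset (Fin m)))) c 0 =
          Finset.univ.map ⟨fun y : Fin (N * B 0) => finProdFinEquiv (c, y),
            fun y z hyz => by simpa using hyz⟩ := by
        ext j
        obtain ⟨⟨d, y⟩, rfl⟩ := finProdFinEquiv.surjective j
        rw [mem_aliveEdges, Finset.mem_map]
        simp only [cls, Equiv.symm_apply_apply, Finset.mem_univ, true_and]
        constructor
        · rintro ⟨rfl, -⟩
          exact ⟨y, rfl⟩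
        · rintro ⟨z, hz⟩
          have := finProdFinEquiv.injective hz
          simp_all
      rw [e, Finset.card_map, Finset.card_univ, Fintype.card_fin]
    · rw [Finset.card_eq_zero, Finset.eq_empty_iff_forall_notMem]
      intro j hj
      exact hi (mem_aliveEdges.1 hj).2.2.symm
  refine presenterWins_of_blockInvariant hm hk hN hB cls _ (fun _ => Nat.zero_le k) ?_
  simp only [hcard]
  have h0 : (B 0 : ℚ) ≠ 0 := by exact_mod_cast (hB.pos 0).ne'
  refine ⟨?_, fun c => by simp, fun c => ⟨0, fun i _ => ?_, fun i hi _ => ?_⟩⟩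
  · simp [Finset.sum_range_succ', h0]
  · simpa using hB.pos i
  · simpa [hi.ne'] using hB.pos i

/-- For all integers `m ≥ 2` and `k ≥ 2`,
`p_OL(k, m) ≤ m³·(k+1)·(m/(m-1))^k`. -/
theorem pOL_upper_bound (m k : ℕ) (hm : 2 ≤ m) (hk : 2 ≤ k) :
    (pOL k m : ℚ) ≤ (m : ℚ) ^ 3 * ((k : ℚ) + 1) * ((m : ℚ) / ((m : ℚ) - 1)) ^ k := by
  obtain ⟨r, rfl⟩ : ∃ r, m = r + 1 := ⟨m - 1, by omega⟩
  have hr : 1 ≤ r := by omega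
  have hr' : (1 : ℚ) ≤ r := by exact_mod_cast hr
  have hwin := presenterWins_init hm (by omega) le_rfl (isBlockSize_ceilGrowth (k := k) hr)
  have hle : pOL k (r + 1) ≤ (r + 1) * ((r + 1 + 1) * k * ceilGrowth r (k - 0)) :=
    Nat.sInf_le hwin
  have hle' : (pOL k (r + 1) : ℚ) ≤ (r + 1) * ((r + 1 + 1) * k * ceilGrowth r k) := by
    exact_mod_cast hle
  refine hle'.trans ?_
  have hC : (ceilGrowth r k : ℚ) ≤ r * (((r : ℚ) + 1) / r) ^ k := by
    have := ceilGrowth_le hr k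
    linarith
  push_cast
  rw [add_sub_cancel_right]
  set q : ℚ := (((r : ℚ) + 1) / r) ^ k
  have hq : 0 ≤ q := by positivity
  have hcoef : ((r : ℚ) + 1 + 1) * k * r ≤ (r + 1) ^ 2 * (k + 1) := by
    have : (0 : ℚ) ≤ k := by positivity
    nlinarith
  calc ((r : ℚ) + 1) * ((r + 1 + 1) * k * ceilGrowth r k)
      ≤ (r + 1) * ((r + 1 + 1) * k * (r * q)) := by gcongr
    _ = (r + 1) * ((r + 1 + 1) * k * r) * q := by ring
    _ ≤ (r + 1) * ((r + 1) ^ 2 * (k + 1)) * q := by gcongr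
    _ = (r + 1) ^ 3 * (k + 1) * q := by ring
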